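/- Let G be a word-hyperbolic group with marked finite generating set A, X = Γ(G,A) its Cayley graph with word metric d_X, δ ≥ 10 an integer such that all geodesic triangles in X are δ-trim, H ≤ G an E-quasiconvex subgroup, and Y = Γ(G/H, A) the relative Cayley graph. Then there exists an integer constant K₁ = K₁(H) > 0 with the following property: if g, f ∈ G are shortest elements (with respect to d_X) of the cosets Hg and Hf respectively, w is the label of a near-geodesic path in Y from Hg to Hf, and h ∈ H satisfies hf = g·w̄, then |h|_X ≤ K₁. -/

import Mathlib

/-! ## Words over a marked generating set and word metrics -/

/-- Evaluation of a word in the letters `A × Bool` (a letter together with a sign,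
`true` = the letter itself, `false` = its inverse) under a marking `π : A → G`. -/
def evalWord {A G : Type*} [Group G] (π : A → G) (w : List (A × Bool)) : G :=
  (w.map fun p => if p.2 then π p.1 else (π p.1)⁻¹).prod

/-- The word length `|g|_X` of `g ∈ G` with respect to the marked generating set `π : A → G`. -/
noncomputable def wordLen {A G : Type*} [Group G] (π : A → G) (g : G) : ℕ :=
  sInf {n | ∃ w : List (A × Bool), w.length = n ∧ evalWord π w = g}

/-- The word metric `d_X` on the Cayley graph `X = Γ(G,A)` (restricted to vertices). -/
noncomputable def dX {A G : Type*} [Group G] (π : A → G) (g₁ g₂ : G) : ℕ :=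
  wordLen π (g₁⁻¹ * g₂)

/-! ## Discrete geodesics, paths, near-geodesics, thinness, trimness -/

/-- A (discrete) geodesic from `x` to `y` in a graph-like metric `d`:
a sequence of vertices `γ 0 = x, …, γ (d x y) = y` with `d (γ i) (γ j) = |i - j|`. -/
def IsDiscGeodesic {X : Type*} (d : X → X → ℕ) (x y : X) (γ : ℕ → X) : Prop :=
  γ 0 = x ∧ γ (d x y) = y ∧
    ∀ i j, i ≤ d x y → j ≤ d x y → d (γ i) (γ j) = Nat.dist i j

/-- A discrete edge-path of length `n`: consecutive vertices at distance at most `1`. -/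
def IsDiscPath {X : Type*} (d : X → X → ℕ) (γ : ℕ → X) (n : ℕ) : Prop :=
  ∀ i < n, d (γ i) (γ (i + 1)) ≤ 1

/-- A near-geodesic from `x` to `y`: a path `p₁ p' p₂` where `p'` is geodesic and the
initial and terminal segments `p₁, p₂` have length at most `1`. -/
def IsNearGeodesicPath {X : Type*} (d : X → X → ℕ) (x y : X) (γ : ℕ → X) (n : ℕ) : Prop :=
  γ 0 = x ∧ γ n = y ∧ IsDiscPath d γ n ∧
    ∃ a b : ℕ, a ≤ 1 ∧ b ≤ 1 ∧ a + b ≤ n ∧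
      ∀ i j, a ≤ i → i ≤ j → j + b ≤ n → d (γ i) (γ j) = j - i

/-- All geodesic triangles of `(X,d)` are `δ`-thin: every side is contained in the closed
`δ`-neighbourhood of the union of the other two sides. -/
def DiscThinTriangles {X : Type*} (d : X → X → ℕ) (δ : ℝ) : Prop :=
  ∀ x y z (γ₁ γ₂ γ₃ : ℕ → X),
    IsDiscGeodesic d x y γ₁ → IsDiscGeodesic d y z γ₂ → IsDiscGeodesic d z x γ₃ →
    ∀ i ≤ d x y, ∃ j,
      (j ≤ d y z ∧ (d (γ₁ i) (γ₂ j) : ℝ) ≤ δ) ∨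
      (j ≤ d z x ∧ (d (γ₁ i) (γ₃ j) : ℝ) ≤ δ)

/-- All geodesic bigons of `(X,d)` are `δ`-thin: each side is contained in the closed
`δ`-neighbourhood of the other. -/
def DiscThinBigons {X : Type*} (d : X → X → ℕ) (δ : ℝ) : Prop :=
  ∀ x y (α β : ℕ → X), IsDiscGeodesic d x y α → IsDiscGeodesic d x y β →
    (∀ i ≤ d x y, ∃ j ≤ d x y, (d (α i) (β j) : ℝ) ≤ δ) ∧
    (∀ i ≤ d x y, ∃ j ≤ d x y, (d (β i) (α j) : ℝ) ≤ δ)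

/-- The Gromov product `(x,y)_z` with respect to the `ℕ`-valued metric `d`. -/
noncomputable def gromovProd {X : Type*} (d : X → X → ℕ) (x y z : X) : ℝ :=
  ((d z x : ℝ) + (d z y : ℝ) - (d x y : ℝ)) / 2

/-- All geodesic triangles of `(X,d)` are `δ`-trim: two points on two sides which are at the
same distance, at most the Gromov product `(x,y)_z`, from the common vertex `z`, are
`δ`-close (this is required for every labelling of the vertices of the triangle). -/
def DiscTrimTriangles {X : Type*} (d : X → X → ℕ) (δ : ℕ) : Prop :=
  ∀ x y z (γ₁ γ₂ : ℕ → X), IsDiscGeodesic d z x γ₁ → IsDiscGeodesic d z y γ₂ →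
    ∀ i, i ≤ d z x → i ≤ d z y → (i : ℝ) ≤ gromovProd d x y z →
      d (γ₁ i) (γ₂ i) ≤ δ

/-- `S ⊆ G` is `C`-quasiconvex w.r.t. `d`: every geodesic with endpoints in `S`
stays in the closed `C`-neighbourhood of `S`. -/
def DiscQuasiconvex {G : Type*} (d : G → G → ℕ) (S : Set G) (C : ℝ) : Prop :=
  ∀ x y (γ : ℕ → G), x ∈ S → y ∈ S → IsDiscGeodesic d x y γ →
    ∀ i ≤ d x y, ∃ h ∈ S, (d (γ i) h : ℝ) ≤ C

/-! ## The relative Cayley graph (Schreier coset graph) -/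

/-- The right coset `Hg` of `g`, as a vertex of the relative Cayley graph `Γ(G/H,A)`. -/
def rcoset {G : Type*} [Group G] (H : Subgroup G) (g : G) :
    Quotient (QuotientGroup.rightRel H) :=
  Quotient.mk (QuotientGroup.rightRel H) g

/-- Right multiplication `Hg ↦ Hga` on right cosets; this is the map tracing the
edges of the relative Cayley graph. -/
def cosetMul {G : Type*} [Group G] (H : Subgroup G)
    (x : Quotient (QuotientGroup.rightRel H)) (g : G) :
    Quotient (QuotientGroup.rightRel H) :=
  Quotient.map (· * g) (fun a b hab => by
    have hab' : b * a⁻¹ ∈ H := QuotientGroup.rightRel_apply.mp hab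
    show QuotientGroup.rightRel H (a * g) (b * g)
    rw [QuotientGroup.rightRel_apply]
    simpa [mul_inv_rev, mul_assoc] using hab') x

/-- The simplicial metric `d_Y` on (the vertices of) the relative Cayley graph
`Y = Γ(G/H, A)`: the least length of a word in the generators leading from one coset
to the other. -/
noncomputable def dY {A G : Type*} [Group G] (π : A → G) (H : Subgroup G)
    (x y : Quotient (QuotientGroup.rightRel H)) : ℕ :=
  sInf {n | ∃ w : List (A × Bool), w.length = n ∧ cosetMul H x (evalWord π w) = y}

/-- `g` is a shortest element of its right coset `Hg` with respect to the word length. -/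
def ShortestInCoset {A G : Type*} [Group G] (π : A → G) (H : Subgroup G) (g : G) : Prop :=
  ∀ h ∈ H, wordLen π g ≤ wordLen π (h * g)

/-- The path in `Y = Γ(G/H,A)` starting at the coset `Hg` and reading the word `w`:
its `n`-th vertex is `Hg·(w̄ restricted to the first n letters)`. -/
def cosetPath {A G : Type*} [Group G] (π : A → G) (H : Subgroup G) (g : G)
    (w : List (A × Bool)) : ℕ → Quotient (QuotientGroup.rightRel H) :=
  fun n => cosetMul H (rcoset H g) (evalWord π (w.take n))

section WordMetric

variable {A G : Type*} [Group G] (π : A → G)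

theorem evalWord_append (u v : List (A × Bool)) :
    evalWord π (u ++ v) = evalWord π u * evalWord π v := by
  simp [evalWord]

theorem exists_evalWord_inv (u : List (A × Bool)) :
    ∃ v : List (A × Bool), v.length = u.length ∧ evalWord π v = (evalWord π u)⁻¹ := by
  induction u with
  | nil => exact ⟨[], rfl, by simp [evalWord]⟩
  | cons p u ih =>
    obtain ⟨v, hv, hev⟩ := ih
    refine ⟨v ++ [(p.1, !p.2)], by simp [hv], ?_⟩
    rw [evalWord_append, hev]
    obtain ⟨a, s⟩ := p
    cases s <;> simp [evalWord]

theorem exists_evalWord_eq (hgen : Subgroup.closure (Set.range π) = ⊤) (g : G) :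
    ∃ w : List (A × Bool), evalWord π w = g := by
  have hg : g ∈ Subgroup.closure (Set.range π) := hgen ▸ Subgroup.mem_top g
  induction hg using Subgroup.closure_induction with
  | mem x hx =>
    obtain ⟨a, rfl⟩ := hx
    exact ⟨[(a, true)], by simp [evalWord]⟩
  | one => exact ⟨[], by simp [evalWord]⟩
  | mul x y _ _ hx hy =>
    obtain ⟨u, rfl⟩ := hx
    obtain ⟨v, rfl⟩ := hy
    exact ⟨u ++ v, evalWord_append π u v⟩
  | inv x _ hx =>
    obtain ⟨u, rfl⟩ := hx
    obtain ⟨v, -, hv⟩ := exists_evalWord_inv π u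
    exact ⟨v, hv⟩

theorem wordLen_evalWord_le (w : List (A × Bool)) : wordLen π (evalWord π w) ≤ w.length :=
  Nat.sInf_le ⟨w, rfl, rfl⟩

variable {π}

theorem exists_length_eq_wordLen (hgen : Subgroup.closure (Set.range π) = ⊤) (g : G) :
    ∃ w : List (A × Bool), w.length = wordLen π g ∧ evalWord π w = g := by
  obtain ⟨w, hw⟩ := exists_evalWord_eq π hgen g
  exact Nat.sInf_mem (s := {n | ∃ w : List (A × Bool), w.length = n ∧ evalWord π w = g})
    ⟨_, w, rfl, hw⟩

theorem wordLen_mul_le (hgen : Subgroup.closure (Set.range π) = ⊤) (g h : G) :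
    wordLen π (g * h) ≤ wordLen π g + wordLen π h := by
  obtain ⟨u, hu, rfl⟩ := exists_length_eq_wordLen hgen g
  obtain ⟨v, hv, rfl⟩ := exists_length_eq_wordLen hgen h
  rw [← hu, ← hv, ← evalWord_append, ← List.length_append]
  exact wordLen_evalWord_le π _

theorem wordLen_inv (hgen : Subgroup.closure (Set.range π) = ⊤) (g : G) :
    wordLen π g⁻¹ = wordLen π g := by
  have key : ∀ x : G, wordLen π x⁻¹ ≤ wordLen π x := fun x => by
    obtain ⟨u, hu, rfl⟩ := exists_length_eq_wordLen hgen x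
    obtain ⟨v, hv, hev⟩ := exists_evalWord_inv π u
    rw [← hu, ← hv, ← hev]
    exact wordLen_evalWord_le π _
  exact le_antisymm (key g) (by simpa using key g⁻¹)

theorem dX_comm (hgen : Subgroup.closure (Set.range π) = ⊤) (x y : G) :
    dX π x y = dX π y x := by
  rw [dX, ← wordLen_inv hgen, mul_inv_rev, inv_inv, dX]

theorem dX_triangle (hgen : Subgroup.closure (Set.range π) = ⊤) (x y z : G) :
    dX π x z ≤ dX π x y + dX π y z := by
  have h := wordLen_mul_le hgen (x⁻¹ * y) (y⁻¹ * z)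
  rwa [mul_assoc, mul_inv_cancel_left] at h

theorem dX_mul_left (g x y : G) : dX π (g * x) (g * y) = dX π x y := by
  simp [dX, mul_assoc]

theorem dX_one_left (x : G) : dX π 1 x = wordLen π x := by
  simp [dX]

theorem exists_isDiscGeodesic (hgen : Subgroup.closure (Set.range π) = ⊤) (x y : G) :
    ∃ γ : ℕ → G, IsDiscGeodesic (dX π) x y γ := by
  obtain ⟨w, hw, hev⟩ := exists_length_eq_wordLen hgen (x⁻¹ * y)
  have hw' : w.length = dX π x y := hw
  have h0 : x * evalWord π (w.take 0) = x := by simp [evalWord]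
  have h1 : x * evalWord π (w.take (dX π x y)) = y := by
    rw [← hw', List.take_length, hev, mul_inv_cancel_left]
  have step : ∀ i j, i ≤ j → j ≤ w.length →
      dX π (x * evalWord π (w.take i)) (x * evalWord π (w.take j)) ≤ j - i := by
    intro i j hij hj
    have hsplit : evalWord π (w.take j) =
        evalWord π (w.take i) * evalWord π ((w.take j).drop i) := by
      rw [← evalWord_append]
      congr 1
      conv_lhs => rw [← List.take_append_drop i (w.take j)]
      rw [List.take_take, min_eq_left hij]
    rw [dX_mul_left, dX, hsplit, inv_mul_cancel_left]
    refine (wordLen_evalWord_le π _).trans ?_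
    simp
    omega
  have main : ∀ i j, i ≤ j → j ≤ w.length →
      dX π (x * evalWord π (w.take i)) (x * evalWord π (w.take j)) = j - i := by
    intro i j hij hj
    have s1 := step 0 i (Nat.zero_le _) (hij.trans hj)
    have s2 := step i j hij hj
    have s3 := step j (dX π x y) (hw' ▸ hj) hw'.ge
    rw [h0] at s1
    rw [h1] at s3
    have t1 := dX_triangle hgen x (x * evalWord π (w.take i)) y
    have t2 := dX_triangle hgen (x * evalWord π (w.take i)) (x * evalWord π (w.take j)) y
    omega
  refine ⟨fun i => x * evalWord π (w.take i), h0, h1, fun i j hi hj => ?_⟩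
  rw [← hw'] at hi hj
  rcases le_total i j with hij | hij
  · rw [main i j hij hj, Nat.dist_eq_sub_of_le hij]
  · rw [dX_comm hgen, main j i hij hi, Nat.dist_eq_sub_of_le_right hij]

theorem IsDiscGeodesic.dist_right {X : Type*} {d : X → X → ℕ} {x y : X} {γ : ℕ → X}
    (hγ : IsDiscGeodesic d x y γ) {i : ℕ} (hi : i ≤ d x y) : d (γ i) y = d x y - i := by
  obtain ⟨-, h1, hd⟩ := hγ
  have h := hd i (d x y) hi le_rfl
  rwa [h1, Nat.dist_eq_sub_of_le hi] at h

theorem DiscTrimTriangles.dist_le {X : Type*} {d : X → X → ℕ} {δ : ℕ}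
    (htrim : DiscTrimTriangles d δ) {x y z : X} {γ₁ γ₂ : ℕ → X}
    (h₁ : IsDiscGeodesic d z x γ₁) (h₂ : IsDiscGeodesic d z y γ₂) {i : ℕ}
    (hx : i ≤ d z x) (hy : i ≤ d z y) (hi : 2 * i + d x y ≤ d z x + d z y) :
    d (γ₁ i) (γ₂ i) ≤ δ := by
  refine htrim x y z γ₁ γ₂ h₁ h₂ i hx hy ?_
  have hi' : (2 * i + d x y : ℝ) ≤ d z x + d z y := by exact_mod_cast hi
  rw [gromovProd]
  linarith

/-- The four-point inequality in a group all of whose geodesic triangles are trim. -/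
theorem dX_four_point (hgen : Subgroup.closure (Set.range π) = ⊤) {δ : ℕ}
    (htrim : DiscTrimTriangles (dX π) δ) (w x y z : G) :
    dX π x z + dX π w y ≤
      max (dX π x y + dX π w z) (dX π y z + dX π w x) + (2 * δ + 2) := by
  obtain ⟨γx, hγx⟩ := exists_isDiscGeodesic hgen w x
  obtain ⟨γy, hγy⟩ := exists_isDiscGeodesic hgen w y
  obtain ⟨γz, hγz⟩ := exists_isDiscGeodesic hgen w z
  have t1 := dX_triangle hgen w x y
  have t2 := dX_triangle hgen w y x
  have t3 := dX_triangle hgen w y z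
  have t4 := dX_triangle hgen w z y
  have c1 := dX_comm hgen x y
  have c2 := dX_comm hgen y z
  obtain ⟨i, hi⟩ : ∃ i, i = min ((dX π w x + dX π w y - dX π x y) / 2)
      ((dX π w y + dX π w z - dX π y z) / 2) := ⟨_, rfl⟩
  have ix : i ≤ dX π w x := by omega
  have iy : i ≤ dX π w y := by omega
  have iz : i ≤ dX π w z := by omega
  have t5 := dX_triangle hgen x w y
  have t6 := dX_triangle hgen y w z
  have c3 := dX_comm hgen x w
  have c4 := dX_comm hgen y w
  have d1 := htrim.dist_le hγx hγy ix iy (by omega)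
  have d2 := htrim.dist_le hγy hγz iy iz (by omega)
  have e1 := hγx.dist_right ix
  have e2 := hγz.dist_right iz
  have c5 := dX_comm hgen x (γx i)
  have u1 := dX_triangle hgen x (γx i) z
  have u2 := dX_triangle hgen (γx i) (γy i) z
  have u3 := dX_triangle hgen (γy i) (γz i) z
  omega

/-- The identity is almost between a shortest coset representative and any element of `H`. -/
theorem ShortestInCoset.wordLen_add_wordLen_le
    (hgen : Subgroup.closure (Set.range π) = ⊤) {δ : ℕ}
    (htrim : DiscTrimTriangles (dX π) δ) {H : Subgroup G} {E : ℕ}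
    (hqc : DiscQuasiconvex (dX π) (H : Set G) (E : ℝ)) {g k : G}
    (hg : ShortestInCoset π H g) (hk : k ∈ H) :
    wordLen π g + wordLen π k ≤ dX π g k + 2 * (δ + E + 1) := by
  obtain ⟨γ, hγ⟩ := exists_isDiscGeodesic hgen 1 g
  obtain ⟨η, hη⟩ := exists_isDiscGeodesic hgen 1 k
  rw [← dX_one_left (π := π) g, ← dX_one_left (π := π) k]
  obtain ⟨i, hi⟩ : ∃ i, i = (dX π 1 g + dX π 1 k - dX π g k) / 2 := ⟨_, rfl⟩
  have t1 := dX_triangle hgen 1 g k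
  have t2 := dX_triangle hgen 1 k g
  have c1 := dX_comm hgen g k
  have t3 := dX_triangle hgen g 1 k
  have c2 := dX_comm hgen g 1
  have ig : i ≤ dX π 1 g := by omega
  have ik : i ≤ dX π 1 k := by omega
  have d1 := htrim.dist_le hγ hη ig ik (by omega)
  obtain ⟨l, hl, hlE⟩ := hqc 1 k η H.one_mem hk hη i ik
  have d2 : dX π (η i) l ≤ E := by exact_mod_cast hlE
  have short : dX π 1 g ≤ dX π l g := by
    rw [dX_one_left]
    exact hg l⁻¹ (H.inv_mem hl)
  have e1 := hγ.dist_right ig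
  have c3 := dX_comm hgen l (γ i)
  have u1 := dX_triangle hgen l (γ i) g
  have u2 := dX_triangle hgen (γ i) (η i) l
  omega

theorem wordLen_le_of_dX_le (hgen : Subgroup.closure (Set.range π) = ⊤) {δ : ℕ}
    (htrim : DiscTrimTriangles (dX π) δ) {H : Subgroup G} {E : ℕ}
    (hqc : DiscQuasiconvex (dX π) (H : Set G) (E : ℝ)) {g f h : G} {C : ℕ}
    (hg : ShortestInCoset π H g) (hf : ShortestInCoset π H f) (hh : h ∈ H)
    (hC : dX π g (h * f) ≤ wordLen π g + wordLen π f + C) :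
    wordLen π h ≤ 6 * δ + 4 * E + 6 + C := by
  have p1 := hg.wordLen_add_wordLen_le hgen htrim hqc hh
  have p2 := hf.wordLen_add_wordLen_le hgen htrim hqc (H.inv_mem hh)
  have e1 : dX π f h⁻¹ = dX π 1 (h * f) := by
    rw [dX_comm hgen, ← dX_mul_left h, mul_inv_cancel]
  have e2 : dX π (h * f) h = wordLen π f := by
    rw [dX_comm hgen, dX, inv_mul_cancel_left]
  rw [wordLen_inv hgen, e1] at p2
  have q := dX_four_point hgen htrim 1 g (h * f) h
  rw [e2, dX_one_left h, dX_one_left g] at q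
  omega

theorem cosetMul_rcoset (H : Subgroup G) (g x : G) :
    cosetMul H (rcoset H g) x = rcoset H (g * x) := rfl

theorem rcoset_mul_left {H : Subgroup G} {h : G} (hh : h ∈ H) (g : G) :
    rcoset H (h * g) = rcoset H g := by
  refine Quotient.sound ?_
  change QuotientGroup.rightRel H (h * g) g
  rw [QuotientGroup.rightRel_apply]
  simpa using hh

theorem dY_rcoset_le (hgen : Subgroup.closure (Set.range π) = ⊤) (H : Subgroup G) (g x : G) :
    dY π H (rcoset H g) (rcoset H (g * x)) ≤ wordLen π x := by
  obtain ⟨u, hu, hev⟩ := exists_length_eq_wordLen hgen x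
  exact Nat.sInf_le ⟨u, hu, by rw [hev, cosetMul_rcoset]⟩

/-- A near-geodesic in the relative Cayley graph is at most `4` longer than any path in the
Cayley graph connecting representatives of its endpoints. -/
theorem IsNearGeodesicPath.length_le (hgen : Subgroup.closure (Set.range π) = ⊤)
    {H : Subgroup G} {g f h : G} {w : List (A × Bool)} (hh : h ∈ H)
    (hfw : h * f = g * evalWord π w)
    (hw : IsNearGeodesicPath (dY π H) (rcoset H g) (rcoset H f) (cosetPath π H g w) w.length) :
    w.length ≤ dX π g f + 4 := by
  obtain ⟨-, -, -, a, b, ha, hb, hab, hgeo⟩ := hw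
  have key := hgeo a (w.length - b) le_rfl (by omega) (by omega)
  set u := evalWord π (w.take a) with hu
  set v := evalWord π (w.drop (w.length - b)) with hv
  have hlu : wordLen π u ≤ a := (wordLen_evalWord_le π _).trans (by simp)
  have hlv : wordLen π v ≤ b := (wordLen_evalWord_le π _).trans (by simp; omega)
  have hsplit : evalWord π w = evalWord π (w.take (w.length - b)) * v := by
    rw [hv, ← evalWord_append, List.take_append_drop]
  have hend : cosetPath π H g w (w.length - b) =
      rcoset H (g * u * (u⁻¹ * (g⁻¹ * f) * v⁻¹)) := by
    have h1 : g * evalWord π (w.take (w.length - b)) =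
        h * (g * u * (u⁻¹ * (g⁻¹ * f) * v⁻¹)) := by
      calc g * evalWord π (w.take (w.length - b)) = g * evalWord π w * v⁻¹ := by
            rw [hsplit]; group
        _ = h * (g * u * (u⁻¹ * (g⁻¹ * f) * v⁻¹)) := by rw [← hfw]; group
    rw [cosetPath, cosetMul_rcoset, h1, rcoset_mul_left hh]
  have hle := dY_rcoset_le hgen H (g * u) (u⁻¹ * (g⁻¹ * f) * v⁻¹)
  rw [← hend] at hle
  change dY π H (cosetPath π H g w a) _ ≤ _ at hle
  have l1 := wordLen_mul_le hgen (u⁻¹ * (g⁻¹ * f)) v⁻¹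
  have l2 := wordLen_mul_le hgen u⁻¹ (g⁻¹ * f)
  rw [wordLen_inv hgen] at l1 l2
  rw [dX]
  omega

end WordMetric

/-- **Lemma 3.3.** Let `G` be a word-hyperbolic group with marked finite generating set `A`,
`X = Γ(G,A)` its Cayley graph with word metric `d_X`, `δ ≥ 10` an integer such that all
geodesic triangles in `X` are `δ`-trim, `H ≤ G` an `E`-quasiconvex subgroup, and
`Y = Γ(G/H,A)` the relative Cayley graph.  Then there exists an integer constant
`K₁ = K₁(H) > 0` with the following property: if `g, f ∈ G` are shortest elements of the
cosets `Hg` and `Hf` respectively, `w` is the label of a near-geodesic path in `Y` from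
`Hg` to `Hf`, and `h ∈ H` satisfies `h·f = g·w̄`, then `|h|_X ≤ K₁`. -/
theorem bounded_coset_discrepancy
    {A G : Type*} [Group G] [Fintype A] (π : A → G)
    (hgen : Subgroup.closure (Set.range π) = ⊤)
    (δ : ℕ) (hδ : 10 ≤ δ) (htrim : DiscTrimTriangles (dX π) δ)
    (H : Subgroup G) (E : ℕ) (hqc : DiscQuasiconvex (dX π) (H : Set G) (E : ℝ)) :
    ∃ K₁ : ℕ, 0 < K₁ ∧
      ∀ (g f : G) (w : List (A × Bool)) (h : G),
        ShortestInCoset π H g → ShortestInCoset π H f → h ∈ H →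
        h * f = g * evalWord π w →
        IsNearGeodesicPath (dY π H) (rcoset H g) (rcoset H f) (cosetPath π H g w) w.length →
        wordLen π h ≤ K₁ := by
  refine ⟨6 * δ + 4 * E + 6 + 4, by omega, fun g f w h hg hf hh hfw hw => ?_⟩
  refine wordLen_le_of_dX_le hgen htrim hqc hg hf hh ?_
  have h1 : dX π g (h * f) ≤ w.length := by
    rw [dX, hfw, inv_mul_cancel_left]
    exact wordLen_evalWord_le π w
  have h2 := hw.length_le hgen hh hfw
  have h3 := wordLen_mul_le hgen g⁻¹ f
  rw [wordLen_inv hgen] at h3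
  exact h1.trans (h2.trans (Nat.add_le_add_right h3 4))
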